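/- arXiv:0804.1886 — 2 statements merged into one kernel-verified Lean document; each statement's English description precedes it below -/
import Mathlib

section
/- Let k be an algebraically closed field of characteristic ≠ 2, m ≥ 1, and σ the involution on (2m)×(2m) matrices given by σ(B) = J B^t J where J = J_{2m} is the standard antisymmetric matrix with J² = -I. If X₁ is a 2m×2m matrix with X₁² = 0, X₁ + σ(X₁) = 0, and rank(X₁) ≤ i, then X₁ is Sp_{2m}(k)-conjugate to a matrix with exactly rank(X₁) nilpotent Jordan blocks of size 2 and the rest size 1, and rank(X₁) is even. -/
open Matrix

/-- The standard antisymmetric matrix `J_N` (for `N = 2m`), with `J² = -I`. -/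
def Jstd (k : Type*) [Field k] (N : ℕ) : Matrix (Fin N) (Fin N) k :=
  Matrix.of fun i j =>
    if (i : ℕ) + (j : ℕ) = N - 1 then (if (i : ℕ) < N / 2 then 1 else -1) else 0

/-- A standard square-zero matrix of rank `t` in the `(-1)`-eigenspace of `σ`:
it has exactly `t` nilpotent Jordan blocks of size `2` and all other blocks of size `1`. -/
def RepMat (k : Type*) [Field k] (m t : ℕ) : Matrix (Fin (2 * m)) (Fin (2 * m)) k :=
  Matrix.of fun p q =>
    if (p : ℕ) < t ∧ (q : ℕ) = 2 * m - t + (p : ℕ) then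
      (if 2 * (p : ℕ) < t then 1 else -1) else 0

set_option linter.unusedSimpArgs false
set_option maxHeartbeats 1000000

/-- Normal-form family of vectors. -/
structure NFam {k V : Type*} [Field k] [AddCommGroup V] [Module k V]
    (B : V →ₗ[k] V →ₗ[k] k) (X : V →ₗ[k] V) (a b : ℕ) (u v p q : ℕ → V) : Prop where
  uu : ∀ i j, B (u i) (u j) = 0
  vv : ∀ i j, B (v i) (v j) = 0
  uv : ∀ i j, B (u i) (v j) = 0
  uXu : ∀ i j, B (u i) (X (u j)) = 0
  vXv : ∀ i j, B (v i) (X (v j)) = 0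
  uXv : ∀ i j, B (u i) (X (v j)) = if i = j ∧ i < a then 1 else 0
  Xp : ∀ i, X (p i) = 0
  Xq : ∀ i, X (q i) = 0
  pp : ∀ i j, B (p i) (p j) = 0
  qq : ∀ i j, B (q i) (q j) = 0
  pq : ∀ i j, B (p i) (q j) = if i = j ∧ i < b then 1 else 0
  up : ∀ i j, B (u i) (p j) = 0
  uq : ∀ i j, B (u i) (q j) = 0
  vp : ∀ i j, B (v i) (p j) = 0
  vq : ∀ i j, B (v i) (q j) = 0

/-- prepend a vector -/
def ncons {V : Type*} (x : V) (f : ℕ → V) : ℕ → V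
  | 0 => x
  | n + 1 => f n

/-- the orthogonal complement of a family -/
def perp {k V : Type*} [Field k] [AddCommGroup V] [Module k V]
    (B : V →ₗ[k] V →ₗ[k] k) {n : ℕ} (e : Fin n → V) : Submodule k V :=
  LinearMap.ker (LinearMap.pi fun i => B (e i))

theorem mem_perp {k V : Type*} [Field k] [AddCommGroup V] [Module k V]
    (B : V →ₗ[k] V →ₗ[k] k) {n : ℕ} (e : Fin n → V) (w : V) :
    w ∈ perp B e ↔ ∀ i, B (e i) w = 0 := by
  simp [perp, funext_iff]

theorem finrank_perp {k V : Type*} [Field k] [AddCommGroup V] [Module k V]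
    [FiniteDimensional k V]
    (B : V →ₗ[k] V →ₗ[k] k) {n : ℕ} (e f : Fin n → V)
    (hef : ∀ i j, B (e i) (f j) = if i = j then 1 else 0) :
    n + Module.finrank k (perp B e) = Module.finrank k V := by
  have h := LinearMap.finrank_range_add_finrank_ker (LinearMap.pi fun i => B (e i))
  have hs : LinearMap.range (LinearMap.pi fun i => B (e i)) = ⊤ := by
    rw [LinearMap.range_eq_top]
    intro c
    refine ⟨∑ j, c j • f j, ?_⟩
    ext i
    simp [hef]
  rw [hs] at h
  have h2 : Module.finrank k (⊤ : Submodule k (Fin n → k)) = n := by simp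
  rw [h2] at h
  exact h

theorem perp_nondeg {k V : Type*} [Field k] [AddCommGroup V] [Module k V]
    (B : V →ₗ[k] V →ₗ[k] k) (halt : ∀ x, B x x = 0)
    (hnd : ∀ x, (∀ y, B x y = 0) → x = 0) {n : ℕ} (e f : Fin n → V)
    (hef : ∀ i j, B (e i) (f j) = if i = j then 1 else 0)
    (hf : ∀ w, (∀ i, B (e i) w = 0) → ∀ i, B (f i) w = 0)
    (x : V) (hx : x ∈ perp B e) (h : ∀ y ∈ perp B e, B x y = 0) : x = 0 := by
  apply hnd
  intro z
  have hneg : ∀ x y, B x y = - B y x := fun x y => by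
    have := halt (x + y)
    simp [halt] at this
    exact eq_neg_of_add_eq_zero_left this
  have h1 := h (z - ∑ j, B (e j) z • f j) (by
    rw [mem_perp]; intro i; simp [hef])
  have h2 := hf x ((mem_perp B e x).1 hx)
  have h3 : ∀ i, B x (f i) = 0 := fun i => by rw [hneg, h2, neg_zero]
  simpa [h3] using h1

theorem exists_nfam {k : Type*} [Field k] (n : ℕ) :
    ∀ {V : Type _} [AddCommGroup V] [Module k V] [FiniteDimensional k V]
    (B : V →ₗ[k] V →ₗ[k] k) (X : V →ₗ[k] V) (halt : ∀ x, B x x = 0)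
    (haltX : ∀ x, B x (X x) = 0)
    (hnd : ∀ x, (∀ y, B x y = 0) → x = 0)
    (hadj : ∀ x y, B (X x) y = B x (X y)) (hX : ∀ x, X (X x) = 0)
    (hn : Module.finrank k V = n),
    ∃ a b u v p q, NFam B X a b u v p q ∧ 4 * a + 2 * b = n := by
  induction n using Nat.strong_induction_on with
  | _ n ih =>
  intro V _ _ _ B X halt haltX hnd hadj hX hn
  have hneg : ∀ x y, B x y = - B y x := fun x y => by
    have := halt (x + y)
    simp [halt] at this
    exact eq_neg_of_add_eq_zero_left this
  have key : ∀ (d : ℕ) (hd : 0 < d) (e f : Fin d → V)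
      (hef : ∀ i j, B (e i) (f j) = if i = j then 1 else 0)
      (hf : ∀ w, (∀ i, B (e i) w = 0) → ∀ i, B (f i) w = 0)
      (hXe : ∀ w, (∀ i, B (e i) w = 0) → ∀ i, B (e i) (X w) = 0),
      ∃ a b u v p q, NFam B X a b u v p q ∧ 4 * a + 2 * b + d = n ∧
        ∀ j i, B (e i) (u j) = 0 ∧ B (e i) (v j) = 0 ∧ B (e i) (p j) = 0 ∧ B (e i) (q j) = 0 := by
    intro d hd e f hef hf hXe
    have hfr := finrank_perp B e f hef
    have hst : ∀ w ∈ perp B e, X w ∈ perp B e := fun w hw => by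
      rw [mem_perp] at *; exact hXe w hw
    obtain ⟨a, b, u, v, p, q, hN, hab⟩ := ih (Module.finrank k (perp B e)) (by omega)
      (V := perp B e) (B.domRestrict₁₂ (perp B e) (perp B e)) (X.restrict hst)
      (fun x => halt x) (fun x => haltX x)
      (fun x hx => by
        have := perp_nondeg B halt hnd e f hef hf x x.2 (fun y hy => by
          exact hx ⟨y, hy⟩)
        exact Subtype.ext this)
      (fun x y => hadj x y) (fun x => Subtype.ext (hX x)) rfl
    refine ⟨a, b, fun i => u i, fun i => v i, fun i => p i, fun i => q i, ?_, by omega, ?_⟩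
    · constructor
      · exact fun i j => hN.uu i j
      · exact fun i j => hN.vv i j
      · exact fun i j => hN.uv i j
      · exact fun i j => hN.uXu i j
      · exact fun i j => hN.vXv i j
      · exact fun i j => hN.uXv i j
      · intro i; exact congrArg Subtype.val (hN.Xp i)
      · intro i; exact congrArg Subtype.val (hN.Xq i)
      · exact fun i j => hN.pp i j
      · exact fun i j => hN.qq i j
      · exact fun i j => hN.pq i j
      · exact fun i j => hN.up i j
      · exact fun i j => hN.uq i j
      · exact fun i j => hN.vp i j
      · exact fun i j => hN.vq i j
    · intro j i
      exact ⟨(mem_perp B e _).1 (u j).2 i, (mem_perp B e _).1 (v j).2 i,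
        (mem_perp B e _).1 (p j).2 i, (mem_perp B e _).1 (q j).2 i⟩
  by_cases hX0 : ∃ u, X u ≠ 0
  · obtain ⟨u0, hu0⟩ := hX0
    obtain ⟨v0, hv0⟩ : ∃ v, B (X u0) v ≠ 0 := by
      by_contra! h
      exact hu0 (hnd _ h)
    obtain ⟨V0, hV0⟩ : ∃ v, B u0 (X v) = 1 :=
      ⟨(B (X u0) v0)⁻¹ • v0, by simp [← hadj, hv0]⟩
    obtain ⟨U0, h1, h2⟩ : ∃ u, B u (X V0) = 1 ∧ B u V0 = 0 :=
      ⟨u0 - (B u0 V0) • X u0, by simp [hadj, hX, hV0], by simp [hadj, hV0]⟩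
    have h3 : B V0 (X U0) = -1 := by rw [← hadj, hneg, h1]
    have h4 : B V0 U0 = 0 := by rw [hneg, h2, neg_zero]
    obtain ⟨a, b, u, v, p, q, hN, hab, ho⟩ := key 4 (by norm_num)
      ![U0, V0, X U0, X V0] ![X V0, - X U0, V0, -U0]
      (by
        intro i j
        fin_cases i <;> fin_cases j <;> simp [h1, h2, h3, h4, hadj, hX, halt, haltX])
      (by
        intro w hw i
        have w0 : B U0 w = 0 := hw 0
        have w1 : B V0 w = 0 := hw 1
        have w2 : B U0 (X w) = 0 := by rw [← hadj]; exact hw 2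
        have w3 : B V0 (X w) = 0 := by rw [← hadj]; exact hw 3
        clear ih key hneg hw
        fin_cases i <;> simp [hadj, hX, w0, w1, w2, w3])
      (by
        intro w hw i
        have w0 : B U0 w = 0 := hw 0
        have w1 : B V0 w = 0 := hw 1
        have w2 : B U0 (X w) = 0 := by rw [← hadj]; exact hw 2
        have w3 : B V0 (X w) = 0 := by rw [← hadj]; exact hw 3
        clear ih key hneg hw
        fin_cases i <;> simp [hadj, hX, w0, w1, w2, w3])
    have o1 : ∀ j, B U0 (u j) = 0 := fun j => (ho j 0).1
    have o2 : ∀ j, B U0 (v j) = 0 := fun j => (ho j 0).2.1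
    have o3 : ∀ j, B U0 (p j) = 0 := fun j => (ho j 0).2.2.1
    have o4 : ∀ j, B U0 (q j) = 0 := fun j => (ho j 0).2.2.2
    have o5 : ∀ j, B V0 (u j) = 0 := fun j => (ho j 1).1
    have o6 : ∀ j, B V0 (v j) = 0 := fun j => (ho j 1).2.1
    have o7 : ∀ j, B V0 (p j) = 0 := fun j => (ho j 1).2.2.1
    have o8 : ∀ j, B V0 (q j) = 0 := fun j => (ho j 1).2.2.2
    have o9 : ∀ j, B U0 (X (u j)) = 0 := fun j => by rw [← hadj]; exact (ho j 2).1
    have o10 : ∀ j, B U0 (X (v j)) = 0 := fun j => by rw [← hadj]; exact (ho j 2).2.1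
    have o11 : ∀ j, B V0 (X (u j)) = 0 := fun j => by rw [← hadj]; exact (ho j 3).1
    have o12 : ∀ j, B V0 (X (v j)) = 0 := fun j => by rw [← hadj]; exact (ho j 3).2.1
    have r1 : ∀ j, B (u j) U0 = 0 := fun j => by rw [hneg, o1, neg_zero]
    have r2 : ∀ j, B (v j) U0 = 0 := fun j => by rw [hneg, o2, neg_zero]
    have r3 : ∀ j, B (u j) V0 = 0 := fun j => by rw [hneg, o5, neg_zero]
    have r4 : ∀ j, B (v j) V0 = 0 := fun j => by rw [hneg, o6, neg_zero]
    have r5 : ∀ j, B (u j) (X U0) = 0 := fun j => by rw [← hadj, hneg, o9, neg_zero]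
    have r6 : ∀ j, B (v j) (X U0) = 0 := fun j => by rw [← hadj, hneg, o10, neg_zero]
    have r7 : ∀ j, B (u j) (X V0) = 0 := fun j => by rw [← hadj, hneg, o11, neg_zero]
    have r8 : ∀ j, B (v j) (X V0) = 0 := fun j => by rw [← hadj, hneg, o12, neg_zero]
    clear ih key ho
    refine ⟨a + 1, b, ncons U0 u, ncons V0 v, p, q, ?_, by omega⟩
    constructor
    · rintro (_ | i) (_ | j) <;> simp [ncons, o1, o2, o3, o4, o5, o6, o7, o8, o9, o10, o11, o12, r1, r2, r3, r4, r5, r6,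
        r7, r8, h1, h2, halt, haltX, hN.uu]
    · rintro (_ | i) (_ | j) <;> simp [ncons, o1, o2, o3, o4, o5, o6, o7, o8, o9, o10, o11, o12, r1, r2, r3, r4, r5, r6,
        r7, r8, h1, h2, halt, haltX, hN.vv]
    · rintro (_ | i) (_ | j) <;> simp [ncons, o1, o2, o3, o4, o5, o6, o7, o8, o9, o10, o11, o12, r1, r2, r3, r4, r5, r6,
        r7, r8, h1, h2, halt, haltX, hN.uv]
    · rintro (_ | i) (_ | j) <;> simp [ncons, o1, o2, o3, o4, o5, o6, o7, o8, o9, o10, o11, o12, r1, r2, r3, r4, r5, r6,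
        r7, r8, h1, h2, halt, haltX, hN.uXu]
    · rintro (_ | i) (_ | j) <;> simp [ncons, o1, o2, o3, o4, o5, o6, o7, o8, o9, o10, o11, o12, r1, r2, r3, r4, r5, r6,
        r7, r8, h1, h2, halt, haltX, hN.vXv]
    · rintro (_ | i) (_ | j) <;> simp [ncons, o1, o2, o3, o4, o5, o6, o7, o8, o9, o10, o11, o12, r1, r2, r3, r4, r5, r6,
        r7, r8, h1, h2, halt, haltX, hN.uXv]
    · exact hN.Xp
    · exact hN.Xq
    · exact hN.pp
    · exact hN.qq
    · exact hN.pq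
    · rintro (_ | i) j <;> simp [ncons, o1, o2, o3, o4, o5, o6, o7, o8, o9, o10, o11, o12, r1, r2, r3, r4, r5, r6,
        r7, r8, h1, h2, halt, haltX, hN.up]
    · rintro (_ | i) j <;> simp [ncons, o1, o2, o3, o4, o5, o6, o7, o8, o9, o10, o11, o12, r1, r2, r3, r4, r5, r6,
        r7, r8, h1, h2, halt, haltX, hN.uq]
    · rintro (_ | i) j <;> simp [ncons, o1, o2, o3, o4, o5, o6, o7, o8, o9, o10, o11, o12, r1, r2, r3, r4, r5, r6,
        r7, r8, h1, h2, halt, haltX, hN.vp]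
    · rintro (_ | i) j <;> simp [ncons, o1, o2, o3, o4, o5, o6, o7, o8, o9, o10, o11, o12, r1, r2, r3, r4, r5, r6,
        r7, r8, h1, h2, halt, haltX, hN.vq]
  push Not at hX0
  by_cases hV : ∃ x : V, x ≠ 0
  · obtain ⟨P0, hP⟩ := hV
    obtain ⟨y, hy⟩ : ∃ y, B P0 y ≠ 0 := by
      by_contra! h
      exact hP (hnd _ h)
    obtain ⟨Q0, h1⟩ : ∃ y, B P0 y = 1 := ⟨(B P0 y)⁻¹ • y, by simp [hy]⟩
    have h2 : B Q0 P0 = -1 := by rw [hneg, h1]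
    obtain ⟨a, b, u, v, p, q, hN, hab, ho⟩ := key 2 (by norm_num)
      ![P0, Q0] ![Q0, -P0]
      (by
        intro i j
        fin_cases i <;> fin_cases j <;> simp [h1, h2, halt])
      (by
        intro w hw i
        have w0 : B P0 w = 0 := hw 0
        have w1 : B Q0 w = 0 := hw 1
        clear ih key hneg hw
        fin_cases i <;> simp [w0, w1])
      (by simp [hX0])
    have o1 : ∀ j, B (u j) P0 = 0 := fun j => by rw [hneg, neg_eq_zero]; exact (ho j 0).1
    have o2 : ∀ j, B (v j) P0 = 0 := fun j => by rw [hneg, neg_eq_zero]; exact (ho j 0).2.1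
    have o3 : ∀ j, B P0 (p j) = 0 := fun j => (ho j 0).2.2.1
    have o4 : ∀ j, B P0 (q j) = 0 := fun j => (ho j 0).2.2.2
    have o5 : ∀ j, B (u j) Q0 = 0 := fun j => by rw [hneg, neg_eq_zero]; exact (ho j 1).1
    have o6 : ∀ j, B (v j) Q0 = 0 := fun j => by rw [hneg, neg_eq_zero]; exact (ho j 1).2.1
    have o7 : ∀ j, B Q0 (p j) = 0 := fun j => (ho j 1).2.2.1
    have o8 : ∀ j, B Q0 (q j) = 0 := fun j => (ho j 1).2.2.2
    have o9 : ∀ j, B (p j) P0 = 0 := fun j => by rw [hneg, o3, neg_zero]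
    have o10 : ∀ j, B (p j) Q0 = 0 := fun j => by rw [hneg, o7, neg_zero]
    have o11 : ∀ j, B (q j) Q0 = 0 := fun j => by rw [hneg, o8, neg_zero]
    refine ⟨a, b + 1, u, v, ncons P0 p, ncons Q0 q, ?_, by omega⟩
    constructor
    · exact hN.uu
    · exact hN.vv
    · exact hN.uv
    · exact hN.uXu
    · exact hN.vXv
    · exact hN.uXv
    · simp [hX0]
    · simp [hX0]
    · rintro (_ | i) (_ | j) <;> simp [ncons, o3, o9, halt, hN.pp]
    · rintro (_ | i) (_ | j) <;> simp [ncons, o8, o11, halt, hN.qq]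
    · rintro (_ | i) (_ | j) <;> simp [ncons, o4, o10, h1, hN.pq]
    · rintro i (_ | j) <;> simp [ncons, o1, hN.up]
    · rintro i (_ | j) <;> simp [ncons, o5, hN.uq]
    · rintro i (_ | j) <;> simp [ncons, o2, hN.vp]
    · rintro i (_ | j) <;> simp [ncons, o6, hN.vq]
  · push Not at hV
    have : Subsingleton V := ⟨fun x y => by rw [hV x, hV y]⟩
    have h0 : n = 0 := by rw [← hn]; exact Module.finrank_zero_of_subsingleton
    refine ⟨0, 0, 0, 0, 0, 0, ?_, by omega⟩
    constructor <;> simp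

theorem Jstd_mul_self (k : Type*) [Field k] (m : ℕ) :
    Jstd k (2 * m) * Jstd k (2 * m) = -1 := by
  ext i j
  rw [Matrix.mul_apply, Finset.sum_eq_single i.rev]
  · have := i.2
    have := j.2
    simp only [Jstd, Matrix.of_apply, Fin.val_rev, Matrix.neg_apply, Matrix.one_apply, Fin.ext_iff]
    split_ifs <;> first | omega | simp
  · intro l _ hl
    have : ¬ ((i : ℕ) + l = 2 * m - 1) := by
      intro h; apply hl; ext; rw [Fin.val_rev]; omega
    simp [Jstd, this]
  · simp

theorem Jstd_transpose (k : Type*) [Field k] (m : ℕ) :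
    (Jstd k (2 * m))ᵀ = - Jstd k (2 * m) := by
  ext i j
  have := i.2
  have := j.2
  simp only [Jstd, Matrix.of_apply, Matrix.neg_apply, Matrix.transpose_apply]
  split_ifs <;> first | omega | simp

theorem rank_RepMat (k : Type*) [Field k] (m t : ℕ) (ht : t ≤ m) :
    (RepMat k m t).rank = t := by
  set D : Matrix (Fin (2 * m)) (Fin (2 * m)) k :=
    Matrix.diagonal fun p => if (p : ℕ) < t then 1 else 0 with hD
  have hDr : D.rank = t := by
    classical
    rw [hD, Matrix.rank_diagonal]
    have : Fintype.card {i : Fin (2 * m) // (if (i : ℕ) < t then (1 : k) else 0) ≠ 0}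
        = Fintype.card (Fin t) := by
      refine Fintype.card_congr ⟨fun i => ⟨i.1, by have := i.2; simpa using this⟩,
        fun i => ⟨⟨i, by omega⟩, by simp⟩, fun i => rfl, fun i => rfl⟩
    rw [this, Fintype.card_fin]
  have h1 : D * RepMat k m t = RepMat k m t := by
    ext i j
    rw [hD, Matrix.diagonal_mul]
    by_cases h : (i : ℕ) < t <;> simp [RepMat, h]
  have h2 : RepMat k m t * (RepMat k m t)ᵀ = D := by
    ext i j
    by_cases h : (i : ℕ) < t
    · rw [Matrix.mul_apply, Finset.sum_eq_single ⟨2 * m - t + i, by omega⟩]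
      · simp only [hD, RepMat, Matrix.of_apply, Matrix.transpose_apply, Matrix.diagonal_apply,
          Fin.ext_iff, and_true]
        split_ifs <;> first | omega | simp
      · intro l _ hl
        have : ¬ ((l : ℕ) = 2 * m - t + i) := fun h => hl (Fin.ext h)
        simp [RepMat, this]
      · simp
    · rw [Matrix.mul_apply]
      simp [RepMat, h, hD, Matrix.diagonal_apply]
  apply le_antisymm
  · rw [← h1]
    exact (Matrix.rank_mul_le_left _ _).trans hDr.le
  · have h3 := Matrix.rank_mul_le_left (RepMat k m t) (RepMat k m t)ᵀ
    rwa [h2, hDr] at h3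

/-- the symplectic normal basis -/
def bas {k V : Type*} [Field k] [AddCommGroup V] [Module k V]
    (X : V →ₗ[k] V) (a b : ℕ) (u v p q : ℕ → V) (i : ℕ) : V :=
  if i < a then X (u i)
  else if i < 2 * a then - X (v (2 * a - 1 - i))
  else if i < 2 * a + b then p (i - 2 * a)
  else if i < 2 * a + 2 * b then q (2 * a + 2 * b - 1 - i)
  else if i < 3 * a + 2 * b then u (i - (2 * a + 2 * b))
  else v (4 * a + 2 * b - 1 - i)

theorem bas_form {k V : Type*} [Field k] [AddCommGroup V] [Module k V]
    (B : V →ₗ[k] V →ₗ[k] k) (X : V →ₗ[k] V) (halt : ∀ x, B x x = 0)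
    (hadj : ∀ x y, B (X x) y = B x (X y)) (hX : ∀ x, X (X x) = 0)
    (a b : ℕ) (u v p q : ℕ → V) (hN : NFam B X a b u v p q)
    (i j : ℕ) (hi : i < 4 * a + 2 * b) (hj : j < 4 * a + 2 * b) :
    B (bas X a b u v p q i) (bas X a b u v p q j) =
      if i + j = 4 * a + 2 * b - 1 then (if i < 2 * a + b then 1 else -1) else 0 := by
  have hneg : ∀ x y, B x y = - B y x := fun x y => by
    have := halt (x + y)
    simp [halt] at this
    exact eq_neg_of_add_eq_zero_left this
  obtain ⟨uu, vv, uv, uXu, vXv, uXv, Xp, Xq, pp, qq, pq, up, uq, vp, vq⟩ := hN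
  have vu : ∀ i j, B (v i) (u j) = 0 := fun i j => by rw [hneg, uv, neg_zero]
  have pu : ∀ i j, B (p i) (u j) = 0 := fun i j => by rw [hneg, up, neg_zero]
  have pv : ∀ i j, B (p i) (v j) = 0 := fun i j => by rw [hneg, vp, neg_zero]
  have qu : ∀ i j, B (q i) (u j) = 0 := fun i j => by rw [hneg, uq, neg_zero]
  have qv : ∀ i j, B (q i) (v j) = 0 := fun i j => by rw [hneg, vq, neg_zero]
  have pX : ∀ i x, B (p i) (X x) = 0 := fun i j => by rw [← hadj, Xp]; simp
  have qX : ∀ i x, B (q i) (X x) = 0 := fun i j => by rw [← hadj, Xq]; simp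
  have qp : ∀ i j, B (q i) (p j) = - if j = i ∧ j < b then 1 else 0 :=
    fun i j => by rw [hneg, pq]
  have vXu : ∀ i j, B (v i) (X (u j)) = - if j = i ∧ j < a then 1 else 0 :=
    fun i j => by rw [← hadj, hneg, uXv]
  unfold bas
  by_cases hc : i + j = 4 * a + 2 * b - 1
  · rw [if_pos hc]
    split_ifs <;> (try omega) <;>
      simp only [map_neg, LinearMap.neg_apply, hadj, hX, uu, vv, uv, uXu, vXv, uXv, Xp, Xq, pp, qq,
        pq, up, uq, vp, vq, vu, pu, pv, qu, qv, pX, qX, qp, vXu, neg_neg, neg_inj] <;>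
      exact if_pos (by omega)
  · rw [if_neg hc]
    split_ifs <;> (try omega) <;>
      simp only [map_neg, LinearMap.neg_apply, hadj, hX, uu, vv, uv, uXu, vXv, uXv, Xp, Xq, pp, qq,
        pq, up, uq, vp, vq, vu, pu, pv, qu, qv, pX, qX, qp, vXu, neg_neg, neg_eq_zero, map_zero,
        neg_zero] <;>
      exact if_neg (by omega)

theorem bas_X {k V : Type*} [Field k] [AddCommGroup V] [Module k V]
    (B : V →ₗ[k] V →ₗ[k] k) (X : V →ₗ[k] V) (hX : ∀ x, X (X x) = 0)
    (a b : ℕ) (u v p q : ℕ → V) (hN : NFam B X a b u v p q)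
    (j : ℕ) (hj : j < 4 * a + 2 * b) :
    X (bas X a b u v p q j) =
      if 2 * a + 2 * b ≤ j then
        (if 2 * (j - (2 * a + 2 * b)) < 2 * a then (1 : k) else -1) •
          bas X a b u v p q (j - (2 * a + 2 * b))
      else 0 := by
  have Xp := hN.Xp
  have Xq := hN.Xq
  unfold bas
  split_ifs <;> (try omega) <;> simp only [map_neg, hX, Xp, Xq, neg_zero, one_smul, neg_smul,
    neg_neg]
  congr 2
  omega

theorem stmt7 (k : Type*) [Field k] [IsAlgClosed k] (hchar : (2 : k) ≠ 0)
    (m : ℕ) (hm : 1 ≤ m) (i : ℕ)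
    (X₁ : Matrix (Fin (2 * m)) (Fin (2 * m)) k)
    (hsq : X₁ * X₁ = 0)
    (hskew : X₁ + Jstd k (2 * m) * X₁ᵀ * Jstd k (2 * m) = 0)
    (hrk : X₁.rank ≤ i) :
    Even X₁.rank ∧
    ∃ g : (Matrix (Fin (2 * m)) (Fin (2 * m)) k)ˣ,
      (g : Matrix (Fin (2 * m)) (Fin (2 * m)) k)ᵀ * Jstd k (2 * m) * g = Jstd k (2 * m) ∧
      (↑g⁻¹ : Matrix (Fin (2 * m)) (Fin (2 * m)) k) * X₁ * g = RepMat k m X₁.rank := by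
  have hJJ := Jstd_mul_self k m
  have hJt := Jstd_transpose k m
  have hJe : ∀ i j, Jstd k (2 * m) i j = if (i : ℕ) + (j : ℕ) = 2 * m - 1 then
    (if (i : ℕ) < 2 * m / 2 then 1 else -1) else 0 := fun i j => rfl
  set J := Jstd k (2 * m) with hJ
  have hJX : X₁ᵀ * J = J * X₁ := by
    have h := congrArg (fun M => J * M) hskew
    simp only [mul_add, mul_zero, ← mul_assoc, hJJ] at h
    rw [neg_one_mul, neg_mul] at h
    exact (sub_eq_zero.1 (by rw [sub_eq_add_neg]; exact h)).symm
  set B : (Fin (2 * m) → k) →ₗ[k] (Fin (2 * m) → k) →ₗ[k] k := Matrix.toLinearMap₂' k J with hB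
  have hBe : ∀ x y, B x y = x ⬝ᵥ (J *ᵥ y) := fun x y => Matrix.toLinearMap₂'_apply' J x y
  set X := Matrix.mulVecLin X₁ with hXd
  have hneg : ∀ x y, B x y = - B y x := fun x y => by
    rw [hBe, hBe, Matrix.dotProduct_mulVec, ← Matrix.mulVec_transpose, hJt, dotProduct_comm,
      Matrix.neg_mulVec, dotProduct_neg]
  have hz : ∀ c : k, c = -c → c = 0 := fun c hc => by
    have : 2 * c = 0 := by linear_combination hc
    exact (mul_eq_zero.1 this).resolve_left hchar
  have halt : ∀ x, B x x = 0 := fun x => hz _ (hneg x x)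
  have hadj : ∀ x y, B (X x) y = B x (X y) := fun x y => by
    simp only [hBe, hXd, Matrix.mulVecLin_apply]
    rw [Matrix.mulVec_mulVec, ← hJX, ← Matrix.mulVec_mulVec,
      Matrix.dotProduct_mulVec x, Matrix.vecMul_transpose]
  have haltX : ∀ x, B x (X x) = 0 := fun x => hz _ (by
    conv_lhs => rw [← hadj, hneg])
  have hX : ∀ x, X (X x) = 0 := fun x => by
    simp [hXd, Matrix.mulVec_mulVec, hsq]
  have hnd : ∀ x, (∀ y, B x y = 0) → x = 0 := fun x hx => by
    have h1 : x ᵥ* J = 0 := by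
      apply dotProduct_eq_zero
      intro w
      rw [← Matrix.dotProduct_mulVec, ← hBe, hx]
    have h2 := congrArg (fun w => w ᵥ* J) h1
    simpa [Matrix.vecMul_vecMul, hJJ, Matrix.vecMul_neg] using h2
  obtain ⟨a, b, u, v, p, q, hN, hab⟩ := exists_nfam (2 * m) B X halt haltX hnd hadj hX (by simp)
  set e := bas X a b u v p q with he
  set G : Matrix (Fin (2 * m)) (Fin (2 * m)) k := Matrix.of fun r j => e j r with hG
  have hGcol : ∀ j, G *ᵥ Pi.single j 1 = e j := fun j => by
    ext r; simp [hG]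
  have hGJ : Gᵀ * J * G = J := by
    ext i j
    have h1 : (Gᵀ * J * G) i j = B (e i) (e j) := by
      rw [hBe, mul_assoc, Matrix.mul_apply, dotProduct]
      rfl
    rw [h1, he, bas_form B X halt hadj hX a b u v p q hN i j (by omega) (by omega), hJe]
    have e1 : 4 * a + 2 * b - 1 = 2 * m - 1 := by omega
    have e2 : 2 * a + b = 2 * m / 2 := by omega
    rw [e1, e2]
  have hinv : (-(J * Gᵀ * J)) * G = 1 := by
    have : J * Gᵀ * J * G = J * (Gᵀ * J * G) := by simp only [mul_assoc]
    rw [neg_mul, this, hGJ, hJJ, neg_neg]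
  have hXG : X₁ * G = G * RepMat k m (2 * a) := by
    ext r j
    have h1 : (X₁ * G) r j = X (e j) r := rfl
    rw [h1, he, bas_X B X hX a b u v p q hN j (by omega), ← he, Matrix.mul_apply]
    by_cases hj : 2 * a + 2 * b ≤ (j : ℕ)
    · rw [if_pos hj, Finset.sum_eq_single ⟨j - (2 * a + 2 * b), by omega⟩]
      · have hc : (j : ℕ) - (2 * a + 2 * b) < 2 * a ∧
          (j : ℕ) = 2 * m - 2 * a + (j - (2 * a + 2 * b)) := by omega
        simp only [hG, RepMat, Matrix.of_apply, if_pos hc, Pi.smul_apply, smul_eq_mul]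
        rw [mul_comm]
      · intro l _ hl
        have : ¬ ((l : ℕ) < 2 * a ∧ (j : ℕ) = 2 * m - 2 * a + l) := by
          intro h; apply hl; ext; simp only; omega
        simp only [RepMat, Matrix.of_apply, if_neg this, mul_zero]
      · simp
    · rw [if_neg hj, Finset.sum_eq_zero]
      · rfl
      · intro l _
        have : ¬ ((l : ℕ) < 2 * a ∧ (j : ℕ) = 2 * m - 2 * a + l) := by omega
        simp only [RepMat, Matrix.of_apply, if_neg this, mul_zero]
  let g : (Matrix (Fin (2 * m)) (Fin (2 * m)) k)ˣ :=
    ⟨G, -(J * Gᵀ * J), mul_eq_one_comm.1 hinv, hinv⟩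
  have hconj : (↑g⁻¹ : Matrix (Fin (2 * m)) (Fin (2 * m)) k) * X₁ * g = RepMat k m (2 * a) := by
    change (-(J * Gᵀ * J)) * X₁ * G = _
    rw [mul_assoc, hXG, ← mul_assoc, hinv, one_mul]
  have hrank : X₁.rank = 2 * a := by
    rw [← rank_RepMat k m (2 * a) (by omega), ← hconj]
    have hu : IsUnit (g : Matrix (Fin (2 * m)) (Fin (2 * m)) k).det :=
      (Matrix.isUnit_iff_isUnit_det _).1 g.isUnit
    have hu' : IsUnit ((g⁻¹ : (Matrix (Fin (2 * m)) (Fin (2 * m)) k)ˣ) :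
        Matrix (Fin (2 * m)) (Fin (2 * m)) k).det :=
      (Matrix.isUnit_iff_isUnit_det _).1 (g⁻¹).isUnit
    rw [Matrix.rank_mul_eq_left_of_isUnit_det _ _ hu, Matrix.rank_mul_eq_right_of_isUnit_det _ _ hu']
  rw [hrank]
  exact ⟨⟨a, by ring⟩, g, hGJ, hconj⟩
end

section
/- Let A be a commutative ring, π ∈ A, π₀ = π². Fix integers s ≤ m and put r = 2m - s. Suppose a is an r×s matrix, c an s×s matrix, d an s×r matrix over A, and define the r×r matrix b (with blocks of the appropriate sizes) by b = [[π a^{[r-s]}, -π I_{r-s}], [π₀ c + π d' a^{[r-s]}, -π d']], where a^{[r-s]} denotes the first r-s rows of a and d' = d_{[r-s]} the last r-s columns of d. If c + ι(c) = 0, where ι is reflection at the antidiagonal, ι(c) = H_s c^t H_s, and d = -H_s a^t J_{m,m-s}, where J_{m,m-s} is the r×r antidiagonal matrix with H_{m-s} upper right and -H_m lower left, then b satisfies b = -J_{m,m-s} b^t J_{m,m-s}. -/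
open Matrix

/-- The unit antidiagonal matrix `H_s`. -/
def Hmat (A : Type*) [CommRing A] (s : ℕ) : Matrix (Fin s) (Fin s) A :=
  Matrix.of fun i j => if (i : ℕ) + (j : ℕ) = s - 1 then 1 else 0

/-- The antidiagonal matrix `J_{m,m-s}` of size `r = 2m - s`, with `H_{m-s}` in the
upper right and `-H_m` in the lower left: its antidiagonal entries are `1` in the first
`m - s` rows and `-1` in the remaining `m` rows. -/
def Jms (A : Type*) [CommRing A] (m s : ℕ) :
    Matrix (Fin (2 * m - s)) (Fin (2 * m - s)) A :=
  Matrix.of fun i j =>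
    if (i : ℕ) + (j : ℕ) = 2 * m - s - 1 then (if (i : ℕ) < m - s then 1 else -1) else 0

/-- Sign of the `i`-th row of `Jms`. -/
def epsJ (A : Type*) [CommRing A] (m s : ℕ) (i : ℕ) : A := if i < m - s then 1 else -1

lemma Hmat_eq (A : Type*) [CommRing A] (s : ℕ) (i j : Fin s) :
    Hmat A s i j = if j = i.rev then 1 else 0 := by
  have h : ((i : ℕ) + (j : ℕ) = s - 1) ↔ j = i.rev := by
    rw [Fin.ext_iff, Fin.val_rev]; omega
  simp only [Hmat, Matrix.of_apply, h]

lemma Jms_eq (A : Type*) [CommRing A] (m s : ℕ) (i j : Fin (2 * m - s)) :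
    Jms A m s i j = if j = i.rev then epsJ A m s i else 0 := by
  have h : ((i : ℕ) + (j : ℕ) = 2 * m - s - 1) ↔ j = i.rev := by
    rw [Fin.ext_iff, Fin.val_rev]; omega
  simp only [Jms, Matrix.of_apply, h, epsJ]

lemma Jms_mul (A : Type*) [CommRing A] (m s : ℕ) {n : Type*}
    (M : Matrix (Fin (2 * m - s)) n A) (i j) :
    (Jms A m s * M) i j = epsJ A m s i * M i.rev j := by
  simp [Matrix.mul_apply, Jms_eq]

lemma mul_Jms (A : Type*) [CommRing A] (m s : ℕ) {n : Type*}
    (M : Matrix n (Fin (2 * m - s)) A) (i j) :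
    (M * Jms A m s) i j = M i j.rev * epsJ A m s (j.rev : Fin _) := by
  have h : ∀ x : Fin (2 * m - s), (j = x.rev) ↔ (x = j.rev) := fun x =>
    ⟨fun h => by simp [h], fun h => by simp [h]⟩
  simp [Matrix.mul_apply, Jms_eq, h]

lemma Hmat_mul (A : Type*) [CommRing A] (s : ℕ) {n : Type*}
    (M : Matrix (Fin s) n A) (i j) :
    (Hmat A s * M) i j = M i.rev j := by
  simp [Matrix.mul_apply, Hmat_eq]

lemma mul_Hmat (A : Type*) [CommRing A] (s : ℕ) {n : Type*}
    (M : Matrix n (Fin s) A) (i j) :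
    (M * Hmat A s) i j = M i j.rev := by
  have h : ∀ x : Fin s, (j = x.rev) ↔ (x = j.rev) := fun x =>
    ⟨fun h => by simp [h], fun h => by simp [h]⟩
  simp [Matrix.mul_apply, Hmat_eq, h]

lemma epsJ_sq (A : Type*) [CommRing A] (m s i : ℕ) : epsJ A m s i * epsJ A m s i = 1 := by
  unfold epsJ; split_ifs <;> simp

lemma epsJ_hi (A : Type*) [CommRing A] (m s i : ℕ) (h : m - s ≤ i) : epsJ A m s i = -1 := by
  unfold epsJ; rw [if_neg (by omega)]

lemma epsJ_flip (A : Type*) [CommRing A] (m s i j : ℕ) (h : i + j + 1 = 2 * m - 2 * s) :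
    epsJ A m s i = - epsJ A m s j := by
  unfold epsJ
  by_cases hi : i < m - s
  · rw [if_pos hi, if_neg (by omega)]; simp
  · rw [if_neg hi, if_pos (by omega)]

/-- In the even case `n = 2m`, `r = 2m - s`: the matrix
`b = [[π a^{[r-s]}, -π I_{r-s}], [π₀ c + π d' a^{[r-s]}, -π d']]` (with `π₀ = π²` and
`d'` the last `r-s` columns of `d`) satisfies `b = -J_{m,m-s} bᵀ J_{m,m-s}`, provided
`c + ι(c) = 0` and `d = -H_s aᵀ J_{m,m-s}`. -/
theorem stmt14 (A : Type*) [CommRing A] (m s : ℕ) (hs : s ≤ m) (π : A)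
    (a : Matrix (Fin (2 * m - s)) (Fin s) A)
    (c : Matrix (Fin s) (Fin s) A)
    (d : Matrix (Fin s) (Fin (2 * m - s)) A)
    (hc : c + Hmat A s * cᵀ * Hmat A s = 0)
    (hd : d = -(Hmat A s * aᵀ * Jms A m s))
    (b : Matrix (Fin (2 * m - s)) (Fin (2 * m - s)) A)
    (hb : b = Matrix.of fun i j : Fin (2 * m - s) =>
      if hi : (i : ℕ) < 2 * m - 2 * s then
        -- top row block (size r - s = 2m - 2s)
        (if hj : (j : ℕ) < s then
          π * a ⟨(i : ℕ), by have := i.isLt; omega⟩ ⟨(j : ℕ), hj⟩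
        else if (j : ℕ) = (i : ℕ) + s then -π else 0)
      else
        -- bottom row block (size s)
        (if hj : (j : ℕ) < s then
          π ^ 2 * c ⟨(i : ℕ) - (2 * m - 2 * s), by have := i.isLt; omega⟩ ⟨(j : ℕ), hj⟩
            + π * ∑ t : Fin (2 * m - 2 * s),
                d ⟨(i : ℕ) - (2 * m - 2 * s), by have := i.isLt; omega⟩
                    ⟨s + (t : ℕ), by have := t.isLt; omega⟩
                  * a ⟨(t : ℕ), by have := t.isLt; omega⟩ ⟨(j : ℕ), hj⟩
        else
          -π * d ⟨(i : ℕ) - (2 * m - 2 * s), by have := i.isLt; omega⟩ j)) :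
    b = -(Jms A m s * bᵀ * Jms A m s) := by
  have hc' : ∀ k l, c k l = - c l.rev k.rev := by
    intro k l
    have := congrFun (congrFun hc k) l
    rw [Matrix.add_apply, mul_Hmat, Hmat_mul, Matrix.transpose_apply, Matrix.zero_apply] at this
    exact eq_neg_of_add_eq_zero_left this
  have hd' : ∀ k l, d k l = - (a l.rev k.rev * epsJ A m s (l.rev : Fin _)) := by
    intro k l
    rw [hd, Matrix.neg_apply, mul_Jms, Hmat_mul, Matrix.transpose_apply]
  clear hc hd
  ext i j
  rw [Matrix.neg_apply, mul_Jms, Jms_mul, Matrix.transpose_apply]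
  have hi' := i.isLt
  have hj' := j.isLt
  have hir := Fin.val_rev i
  have hjr := Fin.val_rev j
  subst hb
  simp only [Matrix.of_apply]
  by_cases hi : (i : ℕ) < 2 * m - 2 * s <;> by_cases hj : (j : ℕ) < s
  · rw [dif_pos hi, dif_pos hj, dif_neg (by omega), dif_neg (by omega), hd']
    rw [epsJ_hi A m s (j.rev : Fin _) (by omega), Fin.rev_rev]
    have e1 : (⟨(i : ℕ), by omega⟩ : Fin (2 * m - s)) = i := rfl
    have e2 : (Fin.rev ⟨(j.rev : ℕ) - (2 * m - 2 * s), by omega⟩ : Fin s) = ⟨j, hj⟩ := by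
      ext; simp only [Fin.val_rev]; omega
    rw [e2]
    linear_combination (-π * a i ⟨j, hj⟩) * epsJ_sq A m s i
  · rw [dif_pos hi, dif_neg hj, dif_pos (by omega), dif_neg (by omega)]
    by_cases h : (j : ℕ) = i + s
    · rw [if_pos h, if_pos (by omega), epsJ_flip A m s (j.rev : Fin _) i (by omega)]
      linear_combination π * epsJ_sq A m s i
    · rw [if_neg h, if_neg (by omega)]; simp
  · rw [dif_neg hi, dif_pos hj, dif_neg (by omega), dif_pos (by omega)]
    rw [epsJ_hi A m s (j.rev : Fin _) (by omega), epsJ_hi A m s i (by omega), hc']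
    have e1 : (Fin.rev ⟨j, hj⟩ : Fin s) = ⟨(j.rev : ℕ) - (2 * m - 2 * s), by omega⟩ := by
      ext; simp only [Fin.val_rev]; omega
    have e2 : (Fin.rev ⟨(i : ℕ) - (2 * m - 2 * s), by omega⟩ : Fin s) = ⟨i.rev, by omega⟩ := by
      ext; simp only [Fin.val_rev]; omega
    have e3 : (Fin.rev ⟨(j.rev : ℕ) - (2 * m - 2 * s), by omega⟩ : Fin s) = ⟨j, hj⟩ := by
      ext; simp only [Fin.val_rev]; omega
    simp only [hd', e1, e2, e3]
    have key : ∀ p q : Fin s,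
        ∑ t : Fin (2 * m - 2 * s),
          -(a (Fin.rev ⟨s + (t : ℕ), by omega⟩) p *
            epsJ A m s (Fin.rev (⟨s + (t : ℕ), by omega⟩ : Fin (2 * m - s)) : Fin _)) *
            a ⟨(t : ℕ), by omega⟩ q
        = - ∑ t : Fin (2 * m - 2 * s),
          -(a (Fin.rev ⟨s + (t : ℕ), by omega⟩) q *
            epsJ A m s (Fin.rev (⟨s + (t : ℕ), by omega⟩ : Fin (2 * m - s)) : Fin _)) *
            a ⟨(t : ℕ), by omega⟩ p := by
      intro p q
      rw [← Equiv.sum_comp Fin.revPerm, ← Finset.sum_neg_distrib]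
      refine Finset.sum_congr rfl fun t _ => ?_
      have ht := t.isLt
      have f1 : (Fin.rev ⟨s + ((Fin.revPerm t : Fin _) : ℕ), by omega⟩ : Fin (2 * m - s))
          = ⟨t, by omega⟩ := by
        ext; simp only [Fin.val_rev, Fin.revPerm_apply]; omega
      have f2 : (Fin.rev ⟨s + (t : ℕ), by omega⟩ : Fin (2 * m - s))
          = ⟨((Fin.revPerm t : Fin _) : ℕ), by omega⟩ := by
        ext; simp only [Fin.val_rev, Fin.revPerm_apply]; omega
      rw [f1, f2]
      simp only []
      rw [epsJ_flip A m s t (Fin.revPerm t : Fin _)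
        (by simp only [Fin.val_rev, Fin.revPerm_apply]; omega)]
      ring
    rw [key]
    ring
  · rw [dif_neg hi, dif_neg hj, dif_pos (by omega), dif_pos (by omega), hd']
    have e2 : (Fin.rev ⟨(i : ℕ) - (2 * m - 2 * s), by omega⟩ : Fin s) = ⟨i.rev, by omega⟩ := by
      ext; simp only [Fin.val_rev]; omega
    rw [e2, epsJ_hi A m s i (by omega)]
    ring
end
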